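/- Let (V, L) be a quantized metric space and let x = [x_st] ∈ M_k(V) with x_st = x_st^(1) + i·x_st^(2), where (x_st^(p))* = x_st^(p) for p = 1, 2 and 1 ≤ s, t ≤ k. Suppose λ_st^(p) belongs to the spectrum σ(x_st^(p)) for p = 1, 2 and 1 ≤ s, t ≤ k. Then ‖x − [(λ_st^(1) + i·λ_st^(2))1]‖_k ≤ 2k² L_k(x) diam(V, L). -/

import Mathlib

open scoped ComplexOrder

noncomputable section

/-- The operator (ℓ² → ℓ²) norm of a complex scalar matrix. -/
noncomputable def scalarOpNorm {m n : Type*} [Fintype m] [Fintype n] [DecidableEq n]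
    (γ : Matrix m n ℂ) : ℝ :=
  ‖LinearMap.toContinuousLinearMap (Matrix.toEuclideanLin γ)‖

/-- A matrix order unit space `(V, 1)`: a complex *-vector space with a distinguished
matrix ordering (given by the graded family of positive cones) and an Archimedean
matrix order unit. -/
structure MOUS : Type 1 where
  carrier : Type
  [acg : AddCommGroup carrier]
  [mod : Module ℂ carrier]
  [sam : StarAddMonoid carrier]
  [sm : StarModule ℂ carrier]
  one : carrier
  pos : ∀ n : ℕ, Set (Matrix (Fin n) (Fin n) carrier)
  pos_add : ∀ n, ∀ v ∈ pos n, ∀ w ∈ pos n, v + w ∈ pos n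
  pos_smul : ∀ n (t : ℝ), 0 ≤ t → ∀ v ∈ pos n, (t : ℂ) • v ∈ pos n
  pos_star : ∀ n, ∀ v ∈ pos n, v.conjTranspose = v
  pos_congr : ∀ n m (γ : Matrix (Fin n) (Fin m) ℂ), ∀ v ∈ pos n,
    (Matrix.of fun i j => ∑ k, ∑ l, (star (γ k i) * γ l j) • v k l) ∈ pos m
  proper : ∀ v : Matrix (Fin 1) (Fin 1) carrier, v ∈ pos 1 → -v ∈ pos 1 → v = 0
  unit_pos : ∀ n, Matrix.diagonal (fun _ => one) ∈ pos n
  orderUnit : ∀ v : carrier, star v = v →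
    ∃ t : ℝ, 0 < t ∧
      (Matrix.of fun _ _ => (t : ℂ) • one - v : Matrix (Fin 1) (Fin 1) carrier) ∈ pos 1
  archimedean : ∀ n (v : Matrix (Fin n) (Fin n) carrier),
    (∀ t : ℝ, 0 < t → v + (t : ℂ) • Matrix.diagonal (fun _ => one) ∈ pos n) → v ∈ pos n

attribute [instance] MOUS.acg MOUS.mod MOUS.sam MOUS.sm

/-- Entrywise application of a linear map to a matrix. -/
def mapMat {V W : Type} [AddCommGroup V] [AddCommGroup W] [Module ℂ V] [Module ℂ W]
    (φ : V →ₗ[ℂ] W) {n : ℕ} (a : Matrix (Fin n) (Fin n) V) : Matrix (Fin n) (Fin n) W :=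
  Matrix.of fun i j => φ (a i j)

/-- The direct sum (block diagonal) of two matrices over a vector space. -/
def dsumMat {V : Type} [AddCommGroup V] {m n : ℕ}
    (v : Matrix (Fin m) (Fin m) V) (w : Matrix (Fin n) (Fin n) V) :
    Matrix (Fin (m + n)) (Fin (m + n)) V :=
  Matrix.reindex finSumFinEquiv finSumFinEquiv (Matrix.fromBlocks v 0 0 w)

/-- The two-sided scalar matrix product `α v β`. -/
def mmulMat {V : Type} [AddCommGroup V] [Module ℂ V] {m n : ℕ}
    (α : Matrix (Fin n) (Fin m) ℂ) (v : Matrix (Fin m) (Fin m) V)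
    (β : Matrix (Fin m) (Fin n) ℂ) : Matrix (Fin n) (Fin n) V :=
  Matrix.of fun i j => ∑ k, ∑ l, (α i k * β l j) • v k l

/-- The unit matrix `1ₙ` in `Mₙ(V)`. -/
def MOUS.unitMat (A : MOUS) (n : ℕ) : Matrix (Fin n) (Fin n) A.carrier :=
  Matrix.diagonal fun _ => A.one

/-- The matrix norm determined by the matrix order:
`‖v‖ = inf { t : [[t1, v], [v*, t1]] ≥ 0 }`. -/
def MOUS.matNorm (A : MOUS) {n : ℕ} (v : Matrix (Fin n) (Fin n) A.carrier) : ℝ :=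
  sInf {t : ℝ | (Matrix.reindex finSumFinEquiv finSumFinEquiv
    (Matrix.fromBlocks ((t : ℂ) • A.unitMat n) v v.conjTranspose ((t : ℂ) • A.unitMat n)))
      ∈ A.pos (n + n)}

/-- A matrix Lipschitz seminorm on a matrix order unit space. -/
structure IsMatrixLipschitzSeminorm (A : MOUS)
    (L : ∀ n : ℕ, Matrix (Fin n) (Fin n) A.carrier → ℝ) : Prop where
  nonneg : ∀ n v, 0 ≤ L n v
  add_le : ∀ n v w, L n (v + w) ≤ L n v + L n w
  smul_eq : ∀ n (c : ℂ) v, L n (c • v) = ‖c‖ * L n v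
  null_iff : ∀ n v, L n v = 0 ↔
    ∃ lam : Matrix (Fin n) (Fin n) ℂ, v = Matrix.of fun i j => lam i j • A.one
  dsum_eq : ∀ m n v w, L (m + n) (dsumMat v w) = max (L m v) (L n w)
  mmul_le : ∀ m n (α : Matrix (Fin n) (Fin m) ℂ) v (β : Matrix (Fin m) (Fin n) ℂ),
    L n (mmulMat α v β) ≤ scalarOpNorm α * L m v * scalarOpNorm β
  star_eq : ∀ n v, L n (Matrix.conjTranspose v) = L n v

/-- A matrix seminorm (finite matrix gauge). -/
structure IsMatrixSeminorm (A : MOUS)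
    (N : ∀ n : ℕ, Matrix (Fin n) (Fin n) A.carrier → ℝ) : Prop where
  nonneg : ∀ n v, 0 ≤ N n v
  add_le : ∀ n v w, N n (v + w) ≤ N n v + N n w
  smul_le : ∀ n (c : ℂ) v, N n (c • v) ≤ ‖c‖ * N n v
  dsum_eq : ∀ m n v w, N (m + n) (dsumMat v w) = max (N m v) (N n w)
  mmul_le : ∀ m n (α : Matrix (Fin n) (Fin m) ℂ) v (β : Matrix (Fin m) (Fin n) ℂ),
    N n (mmulMat α v β) ≤ scalarOpNorm α * N m v * scalarOpNorm β

/-- Linear maps from `V` to `Mₙ(ℂ)`; matrix states live here. -/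
abbrev MState (A : MOUS) (n : ℕ) := A.carrier →ₗ[ℂ] Matrix (Fin n) (Fin n) ℂ

/-- The matrix pairing `⟨⟨φ, a⟩⟩ = [φ(a_{ij})] ∈ M_{rn}(ℂ)`. -/
def mpair {A : MOUS} {n r : ℕ} (φ : MState A n) (a : Matrix (Fin r) (Fin r) A.carrier) :
    Matrix (Fin r × Fin n) (Fin r × Fin n) ℂ :=
  Matrix.of fun p q => φ (a p.1 q.1) p.2 q.2

/-- The `n`-th matrix state space: unital completely positive maps `V → Mₙ(ℂ)`. -/
def CS (A : MOUS) (n : ℕ) : Set (MState A n) :=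
  {φ | φ A.one = 1 ∧ ∀ r, ∀ v ∈ A.pos r, (mpair φ v).PosSemidef}

/-- The matrix metric `D_{Lₙ}` on matrix states coming from a matrix Lipschitz seminorm. -/
def Dmet (A : MOUS) (L : ∀ n : ℕ, Matrix (Fin n) (Fin n) A.carrier → ℝ) (n : ℕ)
    (φ ψ : MState A n) : ℝ :=
  sSup {x | ∃ (r : ℕ) (a : Matrix (Fin r) (Fin r) A.carrier), L r a ≤ 1 ∧
    x = scalarOpNorm (mpair φ a - mpair ψ a)}

/-- The BW (pointwise, weak-*) topology on the space of linear maps `V → Mₙ(ℂ)`. -/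
def lmTop (A : MOUS) (n : ℕ) : TopologicalSpace (MState A n) :=
  TopologicalSpace.induced (fun φ => (φ : A.carrier → Matrix (Fin n) (Fin n) ℂ)) inferInstance

/-- The BW topology on the matrix state space. -/
def BWtop (A : MOUS) (n : ℕ) : TopologicalSpace {φ : MState A n // φ ∈ CS A n} :=
  TopologicalSpace.induced Subtype.val (lmTop A n)

/-- The topology on the matrix state space defined by the matrix metric `D_L`. -/
def Dtop (A : MOUS) (L : ∀ n : ℕ, Matrix (Fin n) (Fin n) A.carrier → ℝ) (n : ℕ) :
    TopologicalSpace {φ : MState A n // φ ∈ CS A n} :=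
  TopologicalSpace.generateFrom
    {U | ∃ (φ₀ : {φ : MState A n // φ ∈ CS A n}) (ε : ℝ), 0 < ε ∧
      U = {ψ | Dmet A L n φ₀.1 ψ.1 < ε}}

/-- A matrix Lip-norm: a matrix Lipschitz seminorm for which the `D_L`-topology on
each matrix state space agrees with the BW-topology. -/
structure IsMatrixLipNorm (A : MOUS)
    (L : ∀ n : ℕ, Matrix (Fin n) (Fin n) A.carrier → ℝ)
    extends IsMatrixLipschitzSeminorm A L : Prop where
  top_eq : ∀ n, Dtop A L n = BWtop A n

/-- A unital completely positive linear map between matrix order unit spaces. -/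
structure IsUCP (A B : MOUS) (φ : A.carrier →ₗ[ℂ] B.carrier) : Prop where
  unital : φ A.one = B.one
  cp : ∀ n, ∀ v ∈ A.pos n, mapMat φ v ∈ B.pos n

/-- `L` induces `LB` via the (surjective, UCP) map `φ`:
`LB` is the corresponding family of quotient seminorms. -/
def Induces (A B : MOUS) (φ : A.carrier →ₗ[ℂ] B.carrier)
    (L : ∀ n : ℕ, Matrix (Fin n) (Fin n) A.carrier → ℝ)
    (LB : ∀ n : ℕ, Matrix (Fin n) (Fin n) B.carrier → ℝ) : Prop :=
  ∀ n (b : Matrix (Fin n) (Fin n) B.carrier),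
    LB n b = sInf {x | ∃ a, mapMat φ a = b ∧ x = L n a}

/-- The quotient seminorm of `L` via `φ`. -/
def quotSeminorm (A B : MOUS) (φ : A.carrier →ₗ[ℂ] B.carrier)
    (L : ∀ n : ℕ, Matrix (Fin n) (Fin n) A.carrier → ℝ) (n : ℕ)
    (b : Matrix (Fin n) (Fin n) B.carrier) : ℝ :=
  sInf {x | ∃ a, mapMat φ a = b ∧ x = L n a}

/-- The operator space (matrix order unit space) direct sum `V₁ ⊕ V₂`. -/
def MOUS.prod (A B : MOUS) : MOUS where
  carrier := A.carrier × B.carrier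
  one := (A.one, B.one)
  pos n := {v | (Matrix.of fun i j => (v i j).1) ∈ A.pos n ∧
    (Matrix.of fun i j => (v i j).2) ∈ B.pos n}
  pos_add := by
    rintro n v ⟨hv1, hv2⟩ w ⟨hw1, hw2⟩
    exact ⟨A.pos_add n _ hv1 _ hw1, B.pos_add n _ hv2 _ hw2⟩
  pos_smul := by
    rintro n t ht v ⟨hv1, hv2⟩
    exact ⟨A.pos_smul n t ht _ hv1, B.pos_smul n t ht _ hv2⟩
  pos_star := by
    rintro n v ⟨hv1, hv2⟩
    have h1 := A.pos_star n _ hv1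
    have h2 := B.pos_star n _ hv2
    funext i j
    exact Prod.ext (congrFun (congrFun h1 i) j) (congrFun (congrFun h2 i) j)
  pos_congr := by
    rintro n m γ v ⟨hv1, hv2⟩
    constructor
    · have h1 := A.pos_congr n m γ _ hv1
      convert h1 using 2
      funext i j
      simp [Prod.fst_sum]
    · have h2 := B.pos_congr n m γ _ hv2
      convert h2 using 2
      funext i j
      simp [Prod.snd_sum]
  proper := by
    rintro v ⟨h1, h2⟩ ⟨h3, h4⟩
    have e1 := A.proper _ h1 h3
    have e2 := B.proper _ h2 h4
    funext i j
    exact Prod.ext (congrFun (congrFun e1 i) j) (congrFun (congrFun e2 i) j)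
  unit_pos := by
    intro n
    constructor
    · convert A.unit_pos n using 2
      funext i j
      by_cases hij : i = j <;> simp [Matrix.diagonal_apply, hij]
    · convert B.unit_pos n using 2
      funext i j
      by_cases hij : i = j <;> simp [Matrix.diagonal_apply, hij]
  orderUnit := by
    rintro ⟨a, b⟩ hstar
    have ha : star a = a := congrArg Prod.fst hstar
    have hb : star b = b := congrArg Prod.snd hstar
    obtain ⟨t₁, ht₁, hp₁⟩ := A.orderUnit a ha
    obtain ⟨t₂, ht₂, hp₂⟩ := B.orderUnit b hb
    have huA : (Matrix.of fun _ _ => A.one : Matrix (Fin 1) (Fin 1) A.carrier) ∈ A.pos 1 := by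
      convert A.unit_pos 1 using 2
      funext i j
      simp [Matrix.diagonal_apply, Subsingleton.elim i j]
    have huB : (Matrix.of fun _ _ => B.one : Matrix (Fin 1) (Fin 1) B.carrier) ∈ B.pos 1 := by
      convert B.unit_pos 1 using 2
      funext i j
      simp [Matrix.diagonal_apply, Subsingleton.elim i j]
    refine ⟨t₁ + t₂, add_pos ht₁ ht₂, ?_, ?_⟩
    · have e : (Matrix.of fun _ _ => ((t₁ + t₂ : ℝ) : ℂ) • A.one - a :
          Matrix (Fin 1) (Fin 1) A.carrier)
          = (Matrix.of fun _ _ => (t₁ : ℂ) • A.one - a) +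
            (t₂ : ℂ) • (Matrix.of fun _ _ => A.one) := by
        funext i j
        show ((t₁ + t₂ : ℝ) : ℂ) • A.one - a
          = ((t₁ : ℂ) • A.one - a) + (t₂ : ℂ) • A.one
        push_cast
        rw [add_smul]
        abel
      exact e ▸ A.pos_add 1 _ hp₁ _ (A.pos_smul 1 t₂ ht₂.le _ huA)
    · have e : (Matrix.of fun _ _ => ((t₁ + t₂ : ℝ) : ℂ) • B.one - b :
          Matrix (Fin 1) (Fin 1) B.carrier)
          = (Matrix.of fun _ _ => (t₂ : ℂ) • B.one - b) +
            (t₁ : ℂ) • (Matrix.of fun _ _ => B.one) := by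
        funext i j
        show ((t₁ + t₂ : ℝ) : ℂ) • B.one - b
          = ((t₂ : ℂ) • B.one - b) + (t₁ : ℂ) • B.one
        push_cast
        rw [add_smul]
        abel
      exact e ▸ B.pos_add 1 _ hp₂ _ (B.pos_smul 1 t₁ ht₁.le _ huB)
  archimedean := by
    rintro n v h
    constructor
    · apply A.archimedean
      intro t ht
      have h1 := (h t ht).1
      have e : (Matrix.of fun i j =>
            (((v + (t : ℂ) • Matrix.diagonal fun _ =>
              ((A.one, B.one) : A.carrier × B.carrier) :
                Matrix (Fin n) (Fin n) (A.carrier × B.carrier))) i j).1)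
          = (Matrix.of fun i j => (v i j).1) +
            (t : ℂ) • Matrix.diagonal fun _ => A.one := by
        funext i j
        by_cases hij : i = j <;>
          simp [Matrix.add_apply, Matrix.smul_apply, Matrix.diagonal_apply, hij]
      rw [e] at h1
      exact h1
    · apply B.archimedean
      intro t ht
      have h2 := (h t ht).2
      have e : (Matrix.of fun i j =>
            (((v + (t : ℂ) • Matrix.diagonal fun _ =>
              ((A.one, B.one) : A.carrier × B.carrier) :
                Matrix (Fin n) (Fin n) (A.carrier × B.carrier))) i j).2)
          = (Matrix.of fun i j => (v i j).2) +
            (t : ℂ) • Matrix.diagonal fun _ => B.one := by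
        funext i j
        by_cases hij : i = j <;>
          simp [Matrix.add_apply, Matrix.smul_apply, Matrix.diagonal_apply, hij]
      rw [e] at h2
      exact h2

/-- First coordinate projection `V₁ ⊕ V₂ → V₁`. -/
def fstL (A B : MOUS) : (A.prod B).carrier →ₗ[ℂ] A.carrier :=
  LinearMap.fst ℂ A.carrier B.carrier

/-- Second coordinate projection `V₁ ⊕ V₂ → V₂`. -/
def sndL (A B : MOUS) : (A.prod B).carrier →ₗ[ℂ] B.carrier :=
  LinearMap.snd ℂ A.carrier B.carrier

/-- `M(L₁, L₂)`: the set of matrix Lip-norms on `V₁ ⊕ V₂` inducing `L₁` and `L₂`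
via the coordinate projections. -/
def MSet (A : MOUS) (LA : ∀ n : ℕ, Matrix (Fin n) (Fin n) A.carrier → ℝ)
    (B : MOUS) (LB : ∀ n : ℕ, Matrix (Fin n) (Fin n) B.carrier → ℝ) :
    Set (∀ n : ℕ, Matrix (Fin n) (Fin n) (A.prod B).carrier → ℝ) :=
  {L | IsMatrixLipNorm (A.prod B) L ∧ Induces (A.prod B) A (fstL A B) L LA ∧
    Induces (A.prod B) B (sndL A B) L LB}

/-- Hausdorff distance between two sets with respect to a distance function. -/
def hDist {X : Type} (d : X → X → ℝ) (s t : Set X) : ℝ :=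
  max (sSup ((fun x => sInf ((fun y => d x y) '' t)) '' s))
      (sSup ((fun y => sInf ((fun x => d x y) '' s)) '' t))

/-- The quantized Gromov–Hausdorff distance between two quantized metric spaces. -/
def distNC (A : MOUS) (LA : ∀ n : ℕ, Matrix (Fin n) (Fin n) A.carrier → ℝ)
    (B : MOUS) (LB : ∀ n : ℕ, Matrix (Fin n) (Fin n) B.carrier → ℝ) : ℝ :=
  sInf {x | ∃ L ∈ MSet A LA B LB, x = ⨆ n : ℕ, ((n : ℝ) ^ 2)⁻¹ *
    hDist (Dmet (A.prod B) L n)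
      ((fun φ : MState A n => φ.comp (fstL A B)) '' CS A n)
      ((fun φ : MState B n => φ.comp (sndL A B)) '' CS B n)}

/-- The diameter of a quantized metric space: the diameter of `CS₁(V)` for `D_{L₁}`. -/
def qDiam (A : MOUS) (LA : ∀ n : ℕ, Matrix (Fin n) (Fin n) A.carrier → ℝ) : ℝ :=
  sSup {x | ∃ φ ∈ CS A 1, ∃ ψ ∈ CS A 1, x = Dmet A LA 1 φ ψ}

/-- Lower semicontinuity of a family of matrix seminorms for the order-unit matrix norms. -/
def IsLSCsem (A : MOUS) (L : ∀ n : ℕ, Matrix (Fin n) (Fin n) A.carrier → ℝ) : Prop :=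
  ∀ n (a : Matrix (Fin n) (Fin n) A.carrier) (c : ℝ), c < L n a →
    ∃ δ : ℝ, 0 < δ ∧ ∀ b, A.matNorm (b - a) < δ → c < L n b


/-- The order-theoretic spectrum of a self-adjoint element of a matrix order unit space:
the interval of real numbers lying between all upper and all lower order bounds of `a`. -/
def ospec (A : MOUS) (a : A.carrier) : Set ℝ :=
  {t : ℝ |
    (∀ s : ℝ, (Matrix.of fun _ _ => (s : ℂ) • A.one - a : Matrix (Fin 1) (Fin 1) A.carrier)
        ∈ A.pos 1 → t ≤ s) ∧
    (∀ s : ℝ, (Matrix.of fun _ _ => a - (s : ℂ) • A.one : Matrix (Fin 1) (Fin 1) A.carrier)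
        ∈ A.pos 1 → s ≤ t)}

/-- A vector is nonnegative when it is so as a `1 × 1` matrix. -/
def MOUS.Nonneg (A : MOUS) (v : A.carrier) : Prop :=
  (Matrix.of fun _ _ => v : Matrix (Fin 1) (Fin 1) A.carrier) ∈ A.pos 1

namespace MOUS

variable {A : MOUS}

lemma Nonneg.add {v w : A.carrier} (hv : A.Nonneg v) (hw : A.Nonneg w) : A.Nonneg (v + w) :=
  A.pos_add 1 _ hv _ hw

lemma Nonneg.smul {v : A.carrier} (hv : A.Nonneg v) {t : ℝ} (ht : 0 ≤ t) : A.Nonneg (t • v) := by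
  rw [← Complex.coe_smul]
  exact A.pos_smul 1 t ht _ hv

lemma nonneg_one (A : MOUS) : A.Nonneg A.one := by
  have h := A.unit_pos 1
  rwa [show (Matrix.diagonal fun _ => A.one : Matrix (Fin 1) (Fin 1) A.carrier)
    = Matrix.of fun _ _ => A.one by ext i j; simp [Subsingleton.elim i j]] at h

lemma nonneg_zero (A : MOUS) : A.Nonneg 0 := by
  simpa using A.nonneg_one.smul le_rfl

lemma Nonneg.star_eq {v : A.carrier} (hv : A.Nonneg v) : star v = v :=
  congrFun (congrFun (A.pos_star 1 _ hv) 0) 0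

lemma star_one (A : MOUS) : star A.one = A.one := A.nonneg_one.star_eq

lemma star_real_smul (t : ℝ) (v : A.carrier) : star (t • v) = t • star v := by
  rw [← Complex.coe_smul, star_smul, ← Complex.coe_smul]
  simp

lemma star_I_smul (v : A.carrier) : star (Complex.I • v) = -(Complex.I • star v) := by
  rw [star_smul]
  simp

lemma exists_nonneg_smul_one_add {v : A.carrier} (hv : star v = v) :
    ∃ t : ℝ, 0 < t ∧ A.Nonneg (t • A.one + v) := by
  obtain ⟨t, ht, h⟩ := A.orderUnit (-v) (by rw [star_neg, hv])
  refine ⟨t, ht, ?_⟩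
  simpa [Nonneg] using h

lemma nonneg_sum_smul {n : ℕ} {v : Matrix (Fin n) (Fin n) A.carrier} (hv : v ∈ A.pos n)
    (c : Fin n → ℂ) : A.Nonneg (∑ k, ∑ l, (star (c k) * c l) • v k l) :=
  A.pos_congr n 1 (Matrix.of fun k _ => c k) v hv

/-- A positive unital functional, seen as a map into `1 × 1` matrices, is a matrix state. -/
lemma exists_mem_CS_of_functional (F : A.carrier →ₗ[ℂ] ℂ) (h1 : F A.one = 1)
    (hstar : ∀ v, F (star v) = star (F v)) (hF : ∀ v, A.Nonneg v → 0 ≤ F v) :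
    ∃ φ ∈ CS A 1, ∀ v, φ v 0 0 = F v := by
  refine ⟨⟨⟨fun v => Matrix.of fun _ _ => F v, fun v w => ?_⟩, fun c v => ?_⟩,
    ⟨?_, fun r v hv => ?_⟩, fun v => rfl⟩
  · ext; simp
  · ext; simp
  · ext i j
    simp [h1, Matrix.one_apply, Subsingleton.elim i j]
  · refine Matrix.PosSemidef.of_dotProduct_mulVec_nonneg ?_ fun x => ?_
    · ext ⟨i, -⟩ ⟨j, -⟩
      have h := congrFun (congrFun (A.pos_star r v hv) i) j
      simp only [Matrix.conjTranspose_apply] at h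
      simp [mpair, Matrix.conjTranspose_apply, ← h, hstar]
    · have h := hF _ (nonneg_sum_smul hv fun k => x (k, 0))
      convert h using 1
      simp [mpair, dotProduct, Matrix.mulVec, Fintype.sum_prod_type, Finset.mul_sum, map_sum]
      refine Finset.sum_congr rfl fun i _ => Finset.sum_congr rfl fun j _ => ?_
      ring

/-- The cone of vectors whose real part lies in the cone generated by the nonnegative vectors
and `-b`. -/
def realPartCone (A : MOUS) (b : A.carrier) : PointedCone ℝ A.carrier where
  carrier := {v | ∃ r : ℝ, 0 ≤ r ∧ A.Nonneg (v + star v + r • b)}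
  add_mem' := by
    rintro v w ⟨r, hr, hv⟩ ⟨s, hs, hw⟩
    refine ⟨r + s, add_nonneg hr hs, ?_⟩
    convert hv.add hw using 1
    rw [star_add, add_smul]
    abel
  zero_mem' := ⟨0, le_rfl, by simpa using A.nonneg_zero⟩
  smul_mem' := by
    rintro ⟨c, hc⟩ v ⟨r, hr, hv⟩
    refine ⟨c * r, mul_nonneg hc hr, ?_⟩
    convert hv.smul hc using 1
    change c • v + star (c • v) + _ = _
    rw [star_real_smul, smul_add, smul_add, mul_smul]

lemma Nonneg.mem_realPartCone {b v : A.carrier} (hv : A.Nonneg v) : v ∈ A.realPartCone b :=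
  ⟨0, le_rfl, by simpa [hv.star_eq] using hv.add hv⟩

lemma mem_realPartCone_of_skew {b v : A.carrier} (hv : star v = -v) : v ∈ A.realPartCone b :=
  ⟨0, le_rfl, by simpa [hv] using A.nonneg_zero⟩

/-- States detect positivity of self-adjoint elements. -/
lemma exists_state_nonpos {b : A.carrier} (hb : star b = b) (hnb : ¬ A.Nonneg b) :
    ∃ φ ∈ CS A 1, (φ b 0 0).re ≤ 0 := by
  have hneg : ∀ c : ℝ, c < 0 → ¬ A.Nonneg (c • A.one) := by
    intro c hc h
    obtain ⟨t, ht, h'⟩ := exists_nonneg_smul_one_add hb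
    apply hnb
    convert h'.add (h.smul (div_nonneg ht.le (neg_nonneg.2 hc.le))) using 1
    rw [smul_smul, div_mul_eq_mul_div, mul_div_assoc, div_neg, div_self hc.ne]
    module
  have hone : A.one ≠ 0 := fun h => hneg (-1) (by norm_num) (by simpa [h] using A.nonneg_zero)
  have key : ∀ c : ℝ, c • A.one ∈ A.realPartCone b → 0 ≤ c := by
    rintro c ⟨r, hr, h⟩
    by_contra! hc
    rw [star_real_smul, A.star_one] at h
    rcases hr.eq_or_lt with rfl | hr
    · apply hneg (2 * c) (by linarith)
      convert h using 1
      module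
    · apply hnb
      have h2 := (h.add (A.nonneg_one.smul (t := -2 * c) (by linarith))).smul (inv_nonneg.2 hr.le)
      convert h2 using 1
      have e : c • A.one + c • A.one + r • b + (-2 * c) • A.one = r • b := by module
      rw [e, smul_smul, inv_mul_cancel₀ hr.ne', one_smul]
  obtain ⟨g, hg1, hg⟩ := riesz_extension (A.realPartCone b)
    (LinearPMap.mkSpanSingleton A.one (1 : ℝ) hone) (by
      rintro ⟨x, hx⟩ hxs
      obtain ⟨c, rfl⟩ := Submodule.mem_span_singleton.1 hx
      rw [LinearPMap.mkSpanSingleton'_apply]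
      simpa using key c hxs) (by
      intro y
      obtain ⟨t, ht, h⟩ := exists_nonneg_smul_one_add (v := y + star y)
        (by rw [star_add, star_star, add_comm])
      refine ⟨⟨(t / 2) • A.one, Submodule.mem_span_singleton.2 ⟨_, rfl⟩⟩, 0, le_rfl, ?_⟩
      convert h using 1
      simp only [star_add, star_real_smul, A.star_one]
      module)
  have g1 : g A.one = 1 :=
    (hg1 ⟨A.one, Submodule.mem_span_singleton_self _⟩).trans
      (LinearPMap.mkSpanSingleton_apply ℝ ℝ hone 1)
  have gskew : ∀ v, star v = -v → g v = 0 := fun v hv => by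
    have h1 := hg v (mem_realPartCone_of_skew hv)
    have h2 := hg (-v) (mem_realPartCone_of_skew (by rw [star_neg, hv]))
    rw [map_neg] at h2
    linarith
  have gstar : ∀ v, g (star v) = g v := fun v => by
    have h := gskew (star v - v) (by rw [star_sub, star_star, neg_sub])
    rw [map_sub] at h
    linarith
  have gI : ∀ v, star v = v → g (Complex.I • v) = 0 := fun v hv =>
    gskew _ (by rw [star_I_smul, hv])
  obtain ⟨φ, hφ, hφg⟩ := exists_mem_CS_of_functional
    (Module.Dual.extendRCLike (𝕜 := ℂ) g)
    (by simp [Module.Dual.extendRCLike_apply, g1, gI _ A.star_one])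
    (fun v => by
      have h : g (Complex.I • star v) = - g (Complex.I • v) := by
        rw [← map_neg, ← gstar, star_I_smul, star_star]
      simp [Module.Dual.extendRCLike_apply, gstar, h])
    (fun v hv => by
      simpa [Module.Dual.extendRCLike_apply, gI _ hv.star_eq] using hg v hv.mem_realPartCone)
  refine ⟨φ, hφ, ?_⟩
  have h := hg (-b) ⟨2, by norm_num, by
    rw [star_neg, hb, show -b + -b + (2 : ℝ) • b = 0 by module]
    exact A.nonneg_zero⟩
  rw [map_neg] at h
  rw [hφg]
  simp [Module.Dual.extendRCLike_apply]
  linarith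

end MOUS

section MatrixMetric

open scoped Matrix.Norms.L2Operator

lemma scalarOpNorm_eq_norm {m n : Type*} [Fintype m] [Fintype n] [DecidableEq n]
    (γ : Matrix m n ℂ) : scalarOpNorm γ = ‖γ‖ := rfl

lemma scalarOpNorm_le_of_mulVec_le {m n : Type*} [Fintype m] [Fintype n] [DecidableEq n]
    (γ : Matrix m n ℂ) {C : ℝ} (hC : 0 ≤ C)
    (h : ∀ x : EuclideanSpace ℂ n, ‖WithLp.toLp 2 (γ.mulVec x)‖ ≤ C * ‖x‖) :
    scalarOpNorm γ ≤ C :=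
  ContinuousLinearMap.opNorm_le_bound _ hC h

lemma scalarOpNorm_row_le_one {m : ℕ} (s : Fin m) :
    scalarOpNorm (Matrix.of fun (_ : Fin 1) j => if j = s then (1 : ℂ) else 0) ≤ 1 := by
  refine scalarOpNorm_le_of_mulVec_le _ zero_le_one fun x => ?_
  rw [one_mul]
  convert PiLp.norm_apply_le x s using 1
  simp [EuclideanSpace.norm_eq, Matrix.mulVec, dotProduct]

lemma scalarOpNorm_col_le_one {m : ℕ} (s : Fin m) :
    scalarOpNorm (Matrix.of fun i (_ : Fin 1) => if i = s then (1 : ℂ) else 0) ≤ 1 := by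
  refine scalarOpNorm_le_of_mulVec_le _ zero_le_one fun x => ?_
  rw [one_mul]
  apply le_of_eq
  simp [EuclideanSpace.norm_eq, Matrix.mulVec, dotProduct, ite_mul, apply_ite]

lemma norm_apply_le_scalarOpNorm {m n : Type*} [Fintype m] [Fintype n] [DecidableEq n]
    (γ : Matrix m n ℂ) (i : m) (j : n) : ‖γ i j‖ ≤ scalarOpNorm γ := by
  have h := Matrix.l2_opNorm_mulVec γ (EuclideanSpace.single j 1)
  rw [PiLp.norm_single, norm_one, mul_one] at h
  refine le_trans ?_ ((PiLp.norm_apply_le _ i).trans h)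
  simp

variable {A : MOUS}

@[simp]
lemma mpair_add {n r : ℕ} (φ ψ : MState A n) (a : Matrix (Fin r) (Fin r) A.carrier) :
    mpair (φ + ψ) a = mpair φ a + mpair ψ a := rfl

@[simp]
lemma mpair_sub {n r : ℕ} (φ ψ : MState A n) (a : Matrix (Fin r) (Fin r) A.carrier) :
    mpair (φ - ψ) a = mpair φ a - mpair ψ a := rfl

@[simp]
lemma mpair_smul {n r : ℕ} (c : ℂ) (φ : MState A n) (a : Matrix (Fin r) (Fin r) A.carrier) :
    mpair (c • φ) a = c • mpair φ a := rfl

/-- `C` bounds the pairing of `η` with the elements of Lipschitz seminorm at most one. -/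
def IsLipBound (L : ∀ n : ℕ, Matrix (Fin n) (Fin n) A.carrier → ℝ) {n : ℕ} (η : MState A n)
    (C : ℝ) : Prop :=
  ∀ r (a : Matrix (Fin r) (Fin r) A.carrier), L r a ≤ 1 → scalarOpNorm (mpair η a) ≤ C

variable {L : ∀ n : ℕ, Matrix (Fin n) (Fin n) A.carrier → ℝ} {n : ℕ}

lemma IsLipBound.sub {η θ : MState A n} {C D : ℝ} (hη : IsLipBound L η C)
    (hθ : IsLipBound L θ D) : IsLipBound L (η - θ) (C + D) := fun r a ha =>
  (norm_sub_le (mpair η a) (mpair θ a)).trans (add_le_add (hη r a ha) (hθ r a ha))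

lemma IsLipBound.smul {η : MState A n} {C : ℝ} (hη : IsLipBound L η C) (c : ℂ) :
    IsLipBound L (c • η) (‖c‖ * C) := fun r a ha =>
  (norm_smul c (mpair η a)).le.trans (mul_le_mul_of_nonneg_left (hη r a ha) (norm_nonneg c))

lemma IsLipBound.of_smul {η : MState A n} {C : ℝ} {c : ℂ} (hc : c ≠ 0)
    (h : IsLipBound L (c • η) C) : IsLipBound L η (‖c‖⁻¹ * C) := by
  have h2 := h.smul c⁻¹
  rwa [smul_smul, inv_mul_cancel₀ hc, one_smul, norm_inv] at h2

lemma isLipBound_Dmet {φ ψ : MState A n} {C : ℝ} (h : IsLipBound L (φ - ψ) C) :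
    IsLipBound L (φ - ψ) (Dmet A L n φ ψ) := fun r a ha =>
  le_csSup ⟨C, by rintro _ ⟨r, a, ha, rfl⟩; exact h r a ha⟩ ⟨r, a, ha, rfl⟩

lemma Dmet_eq_zero_of_not_isLipBound {φ ψ : MState A n}
    (h : ¬ ∃ C, IsLipBound L (φ - ψ) C) : Dmet A L n φ ψ = 0 :=
  Real.sSup_of_not_bddAbove fun ⟨C, hC⟩ => h ⟨C, fun r a ha => hC ⟨r, a, ha, rfl⟩⟩

lemma Dmet_le {φ ψ : MState A n} {C : ℝ} (hC : 0 ≤ C) (h : IsLipBound L (φ - ψ) C) :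
    Dmet A L n φ ψ ≤ C :=
  Real.sSup_le (by rintro _ ⟨r, a, ha, rfl⟩; exact h r a ha) hC

lemma Dmet_nonneg (φ ψ : MState A n) : 0 ≤ Dmet A L n φ ψ :=
  Real.sSup_nonneg (by rintro _ ⟨r, a, ha, rfl⟩; exact norm_nonneg _)

lemma isLipBound_sub_self (φ : MState A n) : IsLipBound L (φ - φ) 0 := fun r a _ => by
  rw [sub_self, scalarOpNorm_eq_norm, show mpair (0 : MState A n) a = 0 from rfl, norm_zero]

lemma Dmet_self (φ : MState A n) : Dmet A L n φ φ = 0 :=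
  le_antisymm (Dmet_le le_rfl (isLipBound_sub_self φ)) (Dmet_nonneg φ φ)

/-- The point at parameter `1 / (k + 1)` on the segment from `φ` to `ψ`. -/
def segPoint (φ ψ : MState A n) (k : ℕ) : MState A n :=
  φ + ((1 / ((k : ℝ) + 1) : ℝ) : ℂ) • (ψ - φ)

lemma segPoint_mem {φ ψ : MState A n} (hφ : φ ∈ CS A n) (hψ : ψ ∈ CS A n) (k : ℕ) :
    segPoint φ ψ k ∈ CS A n := by
  have ht0 : (0 : ℝ) ≤ 1 / ((k : ℝ) + 1) := by positivity
  have ht1 : 1 / ((k : ℝ) + 1) ≤ 1 := by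
    rw [div_le_one (by positivity)]
    linarith [(Nat.cast_nonneg k : (0 : ℝ) ≤ k)]
  unfold segPoint
  generalize 1 / ((k : ℝ) + 1) = t at ht0 ht1
  refine ⟨by simp [hφ.1, hψ.1], fun r v hv => ?_⟩
  have h : mpair (φ + (t : ℂ) • (ψ - φ)) v
      = ((1 - t : ℝ) : ℂ) • mpair φ v + (t : ℂ) • mpair ψ v := by
    simp only [mpair_add, mpair_smul, mpair_sub]
    push_cast
    module
  rw [h]
  exact ((hφ.2 r v hv).smul (Complex.zero_le_real.2 (sub_nonneg.2 ht1))).add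
    ((hψ.2 r v hv).smul (Complex.zero_le_real.2 ht0))

lemma abs_state_le {a : A.carrier} {t : ℝ} (h1 : A.Nonneg (t • A.one + a))
    (h2 : A.Nonneg (t • A.one - a)) {φ : MState A 1} (hφ : φ ∈ CS A 1) (i j : Fin 1) :
    ‖φ a i j‖ ≤ t := by
  have key : ∀ v, A.Nonneg v → 0 ≤ φ v i j := fun v hv => by
    have h := (hφ.2 1 _ hv).diag_nonneg (i := (0, i))
    rwa [Subsingleton.elim j i]
  have e1 : φ A.one i j = 1 := by rw [hφ.1, Subsingleton.elim i j, Matrix.one_apply_eq]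
  have k1 := key _ h1
  have k2 := key _ h2
  rw [← Complex.coe_smul, map_add, map_smul, Matrix.add_apply, Matrix.smul_apply, e1] at k1
  rw [← Complex.coe_smul, map_sub, map_smul, Matrix.sub_apply, Matrix.smul_apply, e1] at k2
  rw [Complex.le_def] at k1 k2
  simp at k1 k2
  have e : φ a i j = ((φ a i j).re : ℂ) := Complex.ext rfl (by simp [← k1.2])
  rw [e, Complex.norm_real, Real.norm_eq_abs, abs_le]
  constructor <;> linarith [k1.1, k2.1]

lemma exists_state_bound_of_selfAdjoint {a : A.carrier} (ha : star a = a) :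
    ∃ C : ℝ, ∀ φ ∈ CS A 1, ∀ i j, ‖φ a i j‖ ≤ C := by
  obtain ⟨s, hs, h1⟩ := MOUS.exists_nonneg_smul_one_add ha
  obtain ⟨t, ht, h2⟩ := MOUS.exists_nonneg_smul_one_add (v := -a) (by rw [star_neg, ha])
  refine ⟨s + t, fun φ hφ i j => abs_state_le ?_ ?_ hφ i j⟩
  · convert h1.add (A.nonneg_one.smul ht.le) using 1
    module
  · convert h2.add (A.nonneg_one.smul hs.le) using 1
    module

lemma exists_state_bound (a : A.carrier) :
    ∃ C : ℝ, ∀ φ ∈ CS A 1, ∀ i j, ‖φ a i j‖ ≤ C := by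
  obtain ⟨C, hC⟩ := exists_state_bound_of_selfAdjoint (a := a + star a)
    (by rw [star_add, star_star, add_comm])
  obtain ⟨D, hD⟩ := exists_state_bound_of_selfAdjoint (a := Complex.I • (a - star a))
    (by rw [MOUS.star_I_smul, star_sub, star_star, ← smul_neg, neg_sub])
  refine ⟨C + D, fun φ hφ i j => ?_⟩
  have e : a = (2 : ℂ)⁻¹ • ((a + star a) - Complex.I • Complex.I • (a - star a)) := by
    rw [smul_smul Complex.I, Complex.I_mul_I]
    module
  have h1 := hC φ hφ i j
  have h2 := hD φ hφ i j
  rw [e, map_smul, map_sub, map_smul φ Complex.I (Complex.I • _), Matrix.smul_apply,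
    Matrix.sub_apply, Matrix.smul_apply, norm_smul]
  have h3 := norm_sub_le (φ (a + star a) i j) (Complex.I • φ (Complex.I • (a - star a)) i j)
  rw [norm_smul, Complex.norm_I, one_mul] at h3
  have h4 : ‖(2 : ℂ)⁻¹‖ = 2⁻¹ := by simp
  rw [h4]
  linarith [norm_nonneg (φ (a + star a) i j), norm_nonneg (φ (Complex.I • (a - star a)) i j)]

end MatrixMetric

section LipNorm

open scoped Topology

variable {A : MOUS} {L : ∀ n : ℕ, Matrix (Fin n) (Fin n) A.carrier → ℝ} {n : ℕ}

lemma isOpen_Dmet_ball (hL : IsMatrixLipNorm A L) (φ : {φ : MState A n // φ ∈ CS A n}) {ε : ℝ}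
    (hε : 0 < ε) : IsOpen[BWtop A n] {ψ | Dmet A L n φ.1 ψ.1 < ε} := by
  rw [← hL.top_eq]
  exact TopologicalSpace.isOpen_generateFrom_of_mem ⟨φ, ε, hε, rfl⟩

/-- A segment along which the Lipschitz distance is infinite meets every nonempty open set of
the metric topology in all but finitely many of the points `segPoint φ ψ k`. -/
lemma preimage_segPoint_cofinite {φ ψ : {φ : MState A n // φ ∈ CS A n}}
    (h : ¬ ∃ C, IsLipBound L (φ.1 - ψ.1) C) {U : Set {φ : MState A n // φ ∈ CS A n}}
    (hU : IsOpen[Dtop A L n] U) :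
    U = ∅ ∨ ∀ᶠ k in Filter.cofinite,
      (⟨segPoint φ.1 ψ.1 k, segPoint_mem φ.2 ψ.2 k⟩ : {φ : MState A n // φ ∈ CS A n}) ∈ U := by
  induction hU with
  | basic U hU =>
    obtain ⟨χ, ε, hε, rfl⟩ := hU
    right
    refine Set.Subsingleton.finite fun k hk l hl => ?_
    have key : ∀ m, m ∈ {m | ¬ Dmet A L n χ.1 (segPoint φ.1 ψ.1 m) < ε} →
        ∃ C, IsLipBound L (χ.1 - segPoint φ.1 ψ.1 m) C := fun m hm => by
      by_contra hcon
      exact hm (by rw [Dmet_eq_zero_of_not_isLipBound hcon]; exact hε)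
    obtain ⟨C, hC⟩ := key k hk
    obtain ⟨D, hD⟩ := key l hl
    by_contra hkl
    apply h
    have e : (χ.1 - segPoint φ.1 ψ.1 k) - (χ.1 - segPoint φ.1 ψ.1 l)
        = ((1 / ((k : ℝ) + 1) - 1 / ((l : ℝ) + 1) : ℝ) : ℂ) • (φ.1 - ψ.1) := by
      unfold segPoint
      push_cast
      module
    refine ⟨_, IsLipBound.of_smul (c := ((1 / ((k : ℝ) + 1) - 1 / ((l : ℝ) + 1) : ℝ) : ℂ)) ?_
      (e ▸ hC.sub hD)⟩
    rw [Complex.ofReal_ne_zero, sub_ne_zero]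
    intro heq
    rw [div_eq_div_iff (by positivity) (by positivity)] at heq
    apply hkl
    have : (l : ℝ) = k := by linarith
    exact_mod_cast this.symm
  | univ => exact Or.inr (Filter.Eventually.of_forall fun _ => trivial)
  | inter U V _ _ hU hV =>
    rcases hU with rfl | hU
    · exact Or.inl (Set.empty_inter _)
    rcases hV with rfl | hV
    · exact Or.inl (Set.inter_empty _)
    exact Or.inr (hU.and hV)
  | sUnion S _ hS =>
    by_cases hne : ∃ U ∈ S, U ≠ ∅
    · obtain ⟨U, hUS, hU⟩ := hne
      right
      filter_upwards [(hS U hUS).resolve_left hU] with k hk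
      exact ⟨U, hUS, hk⟩
    · push Not at hne
      exact Or.inl (Set.sUnion_eq_empty.2 hne)

lemma continuous_BWtop_eval (a : A.carrier) :
    @Continuous _ _ (BWtop A n) _ fun φ : {φ : MState A n // φ ∈ CS A n} => φ.1 a := by
  let _ := lmTop A n
  let _ := BWtop A n
  have h1 : Continuous fun φ : {φ : MState A n // φ ∈ CS A n} => φ.1 := continuous_induced_dom
  have h2 : Continuous fun φ : MState A n => (φ : A.carrier → Matrix (Fin n) (Fin n) ℂ) :=
    continuous_induced_dom
  exact (continuous_apply a).comp (h2.comp h1)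

/-- The matrix metric of a matrix Lip-norm is finite. -/
lemma exists_isLipBound (hL : IsMatrixLipNorm A L) {φ ψ : MState A n} (hφ : φ ∈ CS A n)
    (hψ : ψ ∈ CS A n) : ∃ C, IsLipBound L (φ - ψ) C := by
  by_contra hcon
  have hne : φ ≠ ψ := by
    rintro rfl
    exact hcon ⟨0, isLipBound_sub_self φ⟩
  obtain ⟨a, ha⟩ : ∃ a, φ a ≠ ψ a := by
    by_contra! h
    exact hne (LinearMap.ext h)
  obtain ⟨i, j, hij⟩ : ∃ i j, φ a i j ≠ ψ a i j := by
    by_contra! h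
    exact ha (Matrix.ext h)
  obtain ⟨U, V, hU, hV, hφU, hψV, hUV⟩ := t2_separation hij
  have hopen : ∀ W : Set ℂ, IsOpen W → IsOpen[Dtop A L n]
      {χ : {φ : MState A n // φ ∈ CS A n} | χ.1 a i j ∈ W} := fun W hW => by
    rw [hL.top_eq]
    let _ := BWtop A n
    have h := (continuous_BWtop_eval (A := A) (n := n) a)
    have h2 : Continuous fun χ : {φ : MState A n // φ ∈ CS A n} => χ.1 a i j :=
      (continuous_apply j).comp ((continuous_apply i).comp h)
    exact hW.preimage h2
  have cof := fun W hW => preimage_segPoint_cofinite (φ := ⟨φ, hφ⟩) (ψ := ⟨ψ, hψ⟩) hcon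
    (hopen W hW)
  have c1 := (cof U hU).resolve_left (Set.nonempty_iff_ne_empty.1 ⟨⟨φ, hφ⟩, hφU⟩)
  have c2 := (cof V hV).resolve_left (Set.nonempty_iff_ne_empty.1 ⟨⟨ψ, hψ⟩, hψV⟩)
  obtain ⟨k, hk1, hk2⟩ := (c1.and c2).exists
  exact Set.disjoint_left.1 hUV hk1 hk2

/-- Points of segments starting at `φ₀` converge to `φ₀` uniformly in the other end. -/
lemma tendsto_segPoint (φ₀ : {φ : MState A 1 // φ ∈ CS A 1}) :
    Filter.Tendsto (fun p : ℕ × {φ : MState A 1 // φ ∈ CS A 1} =>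
      (⟨segPoint φ₀.1 p.2.1 p.1, segPoint_mem φ₀.2 p.2.2 p.1⟩ : {φ : MState A 1 // φ ∈ CS A 1}))
      (Filter.atTop ×ˢ ⊤) (@nhds _ (BWtop A 1) φ₀) := by
  let _ := lmTop A 1
  have h0 : @nhds _ (BWtop A 1) φ₀ = Filter.comap Subtype.val (nhds φ₀.1) :=
    nhds_induced Subtype.val φ₀
  have h1 : nhds φ₀.1 = Filter.comap
      (fun φ : MState A 1 => (φ : A.carrier → Matrix (Fin 1) (Fin 1) ℂ)) (nhds (φ₀.1 : _ → _)) :=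
    nhds_induced _ φ₀.1
  rw [h0, h1, Filter.tendsto_comap_iff, Filter.tendsto_comap_iff, tendsto_pi_nhds]
  intro a
  refine tendsto_pi_nhds.2 fun i => tendsto_pi_nhds.2 fun j => ?_
  obtain ⟨C, hC⟩ := exists_state_bound a
  rw [tendsto_iff_norm_sub_tendsto_zero]
  have hlim : Filter.Tendsto
      (fun p : ℕ × {φ : MState A 1 // φ ∈ CS A 1} => 1 / ((p.1 : ℝ) + 1) * (C + C))
      (Filter.atTop ×ˢ ⊤) (nhds 0) := by
    have h := (tendsto_one_div_add_atTop_nhds_zero_nat (𝕜 := ℝ)).mul_const (C + C)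
    rw [zero_mul] at h
    exact h.comp Filter.tendsto_fst
  refine squeeze_zero (fun _ => norm_nonneg _) (fun p => ?_) hlim
  have e : segPoint φ₀.1 p.2.1 p.1 a i j - φ₀.1 a i j
      = ((1 / ((p.1 : ℝ) + 1) : ℝ) : ℂ) * (p.2.1 a i j - φ₀.1 a i j) := by
    simp [segPoint]
  change ‖segPoint φ₀.1 p.2.1 p.1 a i j - φ₀.1 a i j‖ ≤ _
  have hpos : (0 : ℝ) ≤ 1 / ((p.1 : ℝ) + 1) := by positivity
  rw [e, norm_mul, Complex.norm_real, Real.norm_of_nonneg hpos]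
  exact mul_le_mul_of_nonneg_left ((norm_sub_le _ _).trans
    (add_le_add (hC _ p.2.2 i j) (hC _ φ₀.2 i j))) hpos

/-- The matrix metric of a matrix Lip-norm is bounded on the state space. -/
lemma exists_uniform_isLipBound (hL : IsMatrixLipNorm A L) :
    ∃ C, 0 ≤ C ∧ ∀ φ ∈ CS A 1, ∀ ψ ∈ CS A 1, IsLipBound L (φ - ψ) C := by
  by_cases hne : ∃ φ₀, φ₀ ∈ CS A 1
  swap
  · exact ⟨0, le_rfl, fun φ hφ => (hne ⟨φ, hφ⟩).elim⟩
  obtain ⟨φ₀, hφ₀⟩ := hne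
  have hball : {ψ : {φ : MState A 1 // φ ∈ CS A 1} | Dmet A L 1 φ₀ ψ.1 < 1}
      ∈ @nhds _ (BWtop A 1) ⟨φ₀, hφ₀⟩ := by
    refine @IsOpen.mem_nhds _ (BWtop A 1) _ _ (isOpen_Dmet_ball hL ⟨φ₀, hφ₀⟩ one_pos) ?_
    simp [Dmet_self]
  have hev : ∀ᶠ p : ℕ × {φ : MState A 1 // φ ∈ CS A 1} in Filter.atTop ×ˢ ⊤,
      Dmet A L 1 φ₀ (segPoint φ₀ p.2.1 p.1) < 1 := tendsto_segPoint ⟨φ₀, hφ₀⟩ hball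
  obtain ⟨pa, hpa, pb, hpb, hp⟩ := Filter.eventually_prod_iff.1 hev
  rw [Filter.eventually_top] at hpb
  obtain ⟨k, hk⟩ := hpa.exists
  have key : ∀ ψ ∈ CS A 1, IsLipBound L (φ₀ - ψ) ((k : ℝ) + 1) := fun ψ hψ => by
    have h : Dmet A L 1 φ₀ (segPoint φ₀ ψ k) < 1 :=
      hp hk (y := ⟨ψ, hψ⟩) (hpb _)
    obtain ⟨C, hC⟩ := exists_isLipBound hL hφ₀ (segPoint_mem hφ₀ hψ k)
    have h2 : IsLipBound L (φ₀ - segPoint φ₀ ψ k) 1 :=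
      fun r a ha => (isLipBound_Dmet hC r a ha).trans h.le
    have e : φ₀ - segPoint φ₀ ψ k = ((1 / ((k : ℝ) + 1) : ℝ) : ℂ) • (φ₀ - ψ) := by
      unfold segPoint
      module
    have hpos : (0 : ℝ) < 1 / ((k : ℝ) + 1) := by positivity
    rw [e] at h2
    have h3 := IsLipBound.of_smul (Complex.ofReal_ne_zero.2 hpos.ne') h2
    rwa [Complex.norm_real, Real.norm_of_nonneg hpos.le, mul_one, one_div, inv_inv] at h3
  refine ⟨((k : ℝ) + 1) + ((k : ℝ) + 1), by positivity, fun φ hφ ψ hψ => ?_⟩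
  have e : φ - ψ = (φ₀ - ψ) - (φ₀ - φ) := by abel
  rw [e]
  exact (key ψ hψ).sub (key φ hφ)

lemma isLipBound_qDiam (hL : IsMatrixLipNorm A L) {φ ψ : MState A 1} (hφ : φ ∈ CS A 1)
    (hψ : ψ ∈ CS A 1) : IsLipBound L (φ - ψ) (qDiam A L) := by
  obtain ⟨C, hC0, hC⟩ := exists_uniform_isLipBound hL
  have h : Dmet A L 1 φ ψ ≤ qDiam A L := by
    refine le_csSup ⟨C, ?_⟩ ⟨φ, hφ, ψ, hψ, rfl⟩
    rintro _ ⟨φ, hφ, ψ, hψ, rfl⟩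
    exact Dmet_le hC0 (hC φ hφ ψ hψ)
  exact fun r a ha => (isLipBound_Dmet (hC φ hφ ψ hψ) r a ha).trans h

lemma qDiam_nonneg : 0 ≤ qDiam A L :=
  Real.sSup_nonneg (by rintro _ ⟨φ, _, ψ, _, rfl⟩; exact Dmet_nonneg φ ψ)

/-- States differ on `a` by at most the Lipschitz seminorm of `a` times the diameter. -/
lemma norm_state_sub_le (hL : IsMatrixLipNorm A L) {φ ψ : MState A 1} (hφ : φ ∈ CS A 1)
    (hψ : ψ ∈ CS A 1) (a : A.carrier) :
    ‖φ a 0 0 - ψ a 0 0‖ ≤ L 1 (Matrix.of fun _ _ => a) * qDiam A L := by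
  have key : ∀ c : ℝ, L 1 (Matrix.of fun _ _ => a) < c →
      ‖φ a 0 0 - ψ a 0 0‖ ≤ c * qDiam A L := fun c hc => by
    have hc0 : 0 < c := (hL.nonneg _ _).trans_lt hc
    have hle : L 1 (((c⁻¹ : ℝ) : ℂ) • Matrix.of fun _ _ => a) ≤ 1 := by
      rw [hL.smul_eq, Complex.norm_real, Real.norm_of_nonneg (inv_nonneg.2 hc0.le),
        inv_mul_le_iff₀ hc0, mul_one]
      exact hc.le
    have h := (norm_apply_le_scalarOpNorm _ (0, 0) (0, 0)).trans
      (isLipBound_qDiam hL hφ hψ 1 _ hle)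
    have e : mpair (φ - ψ) (((c⁻¹ : ℝ) : ℂ) • (Matrix.of fun _ _ => a :
        Matrix (Fin 1) (Fin 1) A.carrier)) (0, 0) (0, 0)
        = ((c⁻¹ : ℝ) : ℂ) * (φ a 0 0 - ψ a 0 0) := by
      simp [mpair, mul_sub]
    rwa [e, norm_mul, Complex.norm_real, Real.norm_of_nonneg (inv_nonneg.2 hc0.le),
      inv_mul_le_iff₀ hc0] at h
  refine le_of_forall_pos_le_add fun ε hε => ?_
  have hd : 0 < qDiam A L + 1 := by linarith [qDiam_nonneg (A := A) (L := L)]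
  refine (key (L 1 (Matrix.of fun _ _ => a) + ε / (qDiam A L + 1)) (by
    linarith [div_pos hε hd])).trans ?_
  rw [add_mul, add_le_add_iff_left, div_mul_eq_mul_div, div_le_iff₀ hd]
  nlinarith

end LipNorm

section Norm

variable {A : MOUS} {L : ∀ n : ℕ, Matrix (Fin n) (Fin n) A.carrier → ℝ}

/-- The Lipschitz seminorm of an entry is at most that of the matrix. -/
lemma lip_entry_le (hL : IsMatrixLipschitzSeminorm A L) {k : ℕ}
    (x : Matrix (Fin k) (Fin k) A.carrier) (s t : Fin k) :
    L 1 (Matrix.of fun _ _ => x s t) ≤ L k x := by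
  have h := hL.mmul_le k 1 (Matrix.of fun _ j => if j = s then (1 : ℂ) else 0) x
    (Matrix.of fun i _ => if i = t then (1 : ℂ) else 0)
  have e : mmulMat (Matrix.of fun (_ : Fin 1) j => if j = s then (1 : ℂ) else 0) x
      (Matrix.of fun i (_ : Fin 1) => if i = t then (1 : ℂ) else 0)
      = Matrix.of fun _ _ => x s t := by
    ext i j
    simp [mmulMat, ite_smul]
  rw [e] at h
  refine h.trans ?_
  have hx := hL.nonneg k x
  calc _ ≤ 1 * L k x * 1 := by
        gcongr
        · exact norm_nonneg _
        · exact scalarOpNorm_row_le_one s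
        · exact scalarOpNorm_col_le_one t
    _ = L k x := by ring

lemma lip_half_add_le (hL : IsMatrixLipschitzSeminorm A L) {n : ℕ} {c : ℂ} (hc : ‖c‖ ≤ 2⁻¹)
    {v w : Matrix (Fin n) (Fin n) A.carrier} {C : ℝ} (hv : L n v ≤ C) (hw : L n w ≤ C) :
    L n (c • (v + w)) ≤ C := by
  have h := hL.add_le n v w
  have h0 := hL.nonneg n (v + w)
  rw [hL.smul_eq]
  nlinarith [norm_nonneg c]

lemma lip_realPart_le (hL : IsMatrixLipschitzSeminorm A L) {a b : A.carrier} (ha : star a = a)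
    (hb : star b = b) :
    L 1 (Matrix.of fun _ _ => a) ≤ L 1 (Matrix.of fun _ _ => a + Complex.I • b) := by
  set y : Matrix (Fin 1) (Fin 1) A.carrier := Matrix.of fun _ _ => a + Complex.I • b with hy
  have e : (Matrix.of fun _ _ => a : Matrix (Fin 1) (Fin 1) A.carrier)
      = (2 : ℂ)⁻¹ • (y + y.conjTranspose) := by
    ext i j
    simp only [hy, Matrix.of_apply, Matrix.smul_apply, Matrix.add_apply,
      Matrix.conjTranspose_apply, star_add, MOUS.star_I_smul, ha, hb]
    module
  rw [e]
  exact lip_half_add_le hL (by simp) le_rfl (hL.star_eq 1 y).le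

lemma lip_imaginaryPart_le (hL : IsMatrixLipschitzSeminorm A L) {a b : A.carrier}
    (ha : star a = a) (hb : star b = b) :
    L 1 (Matrix.of fun _ _ => b) ≤ L 1 (Matrix.of fun _ _ => a + Complex.I • b) := by
  have e : L 1 (Matrix.of fun _ _ => a + Complex.I • b)
      = L 1 (Matrix.of fun _ _ => b + Complex.I • -a) := by
    rw [show (Matrix.of fun _ _ => a + Complex.I • b : Matrix (Fin 1) (Fin 1) A.carrier)
      = Complex.I • Matrix.of fun _ _ => b + Complex.I • -a by
        ext i j
        simp [smul_smul, add_comm], hL.smul_eq, Complex.norm_I, one_mul]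
  rw [e]
  exact lip_realPart_le hL hb (by rw [star_neg, ha])

/-- If some state takes at `a` a value close to `c` from below, then `a` lies below
`c + L(a) diam`. -/
lemma nonneg_add_diam_sub (hL : IsMatrixLipNorm A L) {a : A.carrier} (ha : star a = a) {c : ℝ}
    (hc : ∀ s : ℝ, A.Nonneg (a - s • A.one) → s ≤ c) {ε : ℝ} (hε : 0 < ε) :
    A.Nonneg ((c + L 1 (Matrix.of fun _ _ => a) * qDiam A L + ε) • A.one - a) := by
  set R := L 1 (Matrix.of fun _ _ => a) * qDiam A L
  have hval : ∀ χ ∈ CS A 1, ∀ t : ℝ, (χ (t • A.one) 0 0).re = t := fun χ hχ t => by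
    rw [← Complex.coe_smul, map_smul, hχ.1]
    simp
  obtain ⟨φ, hφ, hφa⟩ := MOUS.exists_state_nonpos (b := a - (c + ε / 3) • A.one)
    (by rw [star_sub, MOUS.star_real_smul, A.star_one, ha]) (fun h => by linarith [hc _ h])
  rw [map_sub, Matrix.sub_apply, Complex.sub_re, hval φ hφ] at hφa
  by_contra hcon
  obtain ⟨ψ, hψ, hψa⟩ := MOUS.exists_state_nonpos
    (by rw [star_sub, MOUS.star_real_smul, A.star_one, ha]) hcon
  rw [map_sub, Matrix.sub_apply, Complex.sub_re, hval ψ hψ] at hψa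
  have h := (Complex.abs_re_le_norm _).trans (norm_state_sub_le hL hψ hφ a)
  rw [Complex.sub_re] at h
  linarith [le_abs_self ((ψ a 0 0).re - (φ a 0 0).re)]

/-- Distance, in the order sense, of a self-adjoint element from its spectral values. -/
lemma nonneg_of_mem_ospec (hL : IsMatrixLipNorm A L) {a : A.carrier} (ha : star a = a) {c : ℝ}
    (hc : c ∈ ospec A a) {C : ℝ} (hC : L 1 (Matrix.of fun _ _ => a) * qDiam A L < C) :
    A.Nonneg (C • A.one + (a - c • A.one)) ∧ A.Nonneg (C • A.one - (a - c • A.one)) := by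
  simp only [ospec, Complex.coe_smul] at hc
  set R := L 1 (Matrix.of fun _ _ => a) * qDiam A L with hR
  have hRneg : L 1 (Matrix.of fun _ _ => -a) * qDiam A L = R := by
    rw [show (Matrix.of fun _ _ => -a : Matrix (Fin 1) (Fin 1) A.carrier)
      = (-1 : ℂ) • Matrix.of fun _ _ => a by ext; simp, hL.smul_eq, norm_neg, norm_one, one_mul]
  constructor
  · have h := nonneg_add_diam_sub hL (a := -a) (by rw [star_neg, ha]) (c := -c) (fun s hs => by
      have h2 := hc.1 (-s) (show A.Nonneg _ by convert hs using 1; module)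
      linarith) (sub_pos.2 hC)
    rw [hRneg] at h
    convert h using 1
    module
  · have h := nonneg_add_diam_sub hL ha hc.2 (sub_pos.2 hC)
    rw [← hR] at h
    convert h using 1
    module

/-- The matrices over `Fin k ⊕ Fin k` which are positive. -/
def SumPos (A : MOUS) (k : ℕ) (M : Matrix (Fin k ⊕ Fin k) (Fin k ⊕ Fin k) A.carrier) : Prop :=
  Matrix.reindex finSumFinEquiv finSumFinEquiv M ∈ A.pos (k + k)

lemma MOUS.zero_mem_pos (A : MOUS) (n : ℕ) : 0 ∈ A.pos n := by
  simpa using A.pos_smul n 0 le_rfl _ (A.unit_pos n)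

lemma SumPos.add {k : ℕ} {M N : Matrix (Fin k ⊕ Fin k) (Fin k ⊕ Fin k) A.carrier}
    (hM : SumPos A k M) (hN : SumPos A k N) : SumPos A k (M + N) :=
  A.pos_add _ _ hM _ hN

lemma SumPos.sum {k : ℕ} {ι : Type*} (s : Finset ι)
    {M : ι → Matrix (Fin k ⊕ Fin k) (Fin k ⊕ Fin k) A.carrier}
    (hM : ∀ i ∈ s, SumPos A k (M i)) : SumPos A k (∑ i ∈ s, M i) :=
  Finset.sum_induction M (SumPos A k) (fun _ _ => SumPos.add) (A.zero_mem_pos _) hM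

lemma MOUS.Nonneg.sumPos {k : ℕ} {p : A.carrier} (hp : A.Nonneg p) (w : Fin k ⊕ Fin k → ℂ) :
    SumPos A k (Matrix.of fun i j => (star (w i) * w j) • p) := by
  have h := A.pos_congr 1 (k + k) (Matrix.of fun _ j => w (finSumFinEquiv.symm j)) _ hp
  unfold SumPos
  convert h using 1
  ext i j
  simp

lemma sumPos_single_add_sub {k : ℕ} (s t : Fin k) {p q : A.carrier} (hp : A.Nonneg p)
    (hq : A.Nonneg q) {u : ℂ} (hu : star u * u = 1) :
    SumPos A k (Matrix.fromBlocks (Matrix.single s s (p + q)) (Matrix.single s t (u • (p - q)))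
      (Matrix.single t s (star u • (p - q))) (Matrix.single t t (p + q))) := by
  convert (hp.sumPos (Sum.elim (Pi.single s 1) (Pi.single t u))).add
    (hq.sumPos (Sum.elim (Pi.single s 1) (Pi.single t (-u)))) using 1
  have hu' : (starRingEnd ℂ) u * u = 1 := hu
  ext (i | i) (j | j)
  · rcases eq_or_ne s i with rfl | hi <;> rcases eq_or_ne s j with rfl | hj <;> simp [*]
  · rcases eq_or_ne s i with rfl | hi <;> rcases eq_or_ne t j with rfl | hj <;>
      simp [*, smul_sub, sub_eq_add_neg]
  · rcases eq_or_ne t i with rfl | hi <;> rcases eq_or_ne s j with rfl | hj <;>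
      simp [*, smul_sub, sub_eq_add_neg]
  · rcases eq_or_ne t i with rfl | hi <;> rcases eq_or_ne t j with rfl | hj <;> simp [*]

/-- An off-diagonal self-adjoint entry, multiplied by a phase, is dominated by its bound on the
diagonal. -/
lemma sumPos_single {k : ℕ} (s t : Fin k) {C : ℝ} {a : A.carrier}
    (h1 : A.Nonneg (C • A.one + a)) (h2 : A.Nonneg (C • A.one - a)) {u : ℂ}
    (hu : star u * u = 1) :
    SumPos A k (Matrix.fromBlocks (Matrix.single s s (C • A.one)) (Matrix.single s t (u • a))
      (Matrix.single t s (star u • a)) (Matrix.single t t (C • A.one))) := by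
  have h := sumPos_single_add_sub s t (h1.smul (t := 2⁻¹) (by norm_num))
    (h2.smul (t := 2⁻¹) (by norm_num)) hu
  rwa [show (2⁻¹ : ℝ) • (C • A.one + a) + (2⁻¹ : ℝ) • (C • A.one - a) = C • A.one by module,
    show (2⁻¹ : ℝ) • (C • A.one + a) - (2⁻¹ : ℝ) • (C • A.one - a) = a by module] at h

/-- Entrywise order bounds on the real and imaginary parts bound the matrix norm. -/
lemma sumPos_of_entrywise {k : ℕ} {C : ℝ} {a b : Matrix (Fin k) (Fin k) A.carrier}
    (hsa : ∀ s t, star (a s t) = a s t) (hsb : ∀ s t, star (b s t) = b s t)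
    (ha1 : ∀ s t, A.Nonneg (C • A.one + a s t)) (ha2 : ∀ s t, A.Nonneg (C • A.one - a s t))
    (hb1 : ∀ s t, A.Nonneg (C • A.one + b s t)) (hb2 : ∀ s t, A.Nonneg (C • A.one - b s t)) :
    SumPos A k (Matrix.fromBlocks (((2 * k * C : ℝ) : ℂ) • A.unitMat k) (a + Complex.I • b)
      (a + Complex.I • b).conjTranspose (((2 * k * C : ℝ) : ℂ) • A.unitMat k)) := by
  have h := SumPos.sum Finset.univ fun s (_ : s ∈ Finset.univ) =>
    SumPos.sum Finset.univ fun t (_ : t ∈ Finset.univ) =>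
      (sumPos_single s t (ha1 s t) (ha2 s t) (u := 1) (by simp)).add
        (sumPos_single s t (hb1 s t) (hb2 s t) (u := Complex.I) (by simp))
  convert h using 1
  have hdiag : ((2 * k * C : ℝ) : ℂ) • A.one = k • C • A.one + k • C • A.one := by
    rw [Complex.coe_smul]
    module
  ext (i | i) (j | j)
  · rcases eq_or_ne i j with rfl | hij
    · simpa [MOUS.unitMat, Matrix.sum_apply, Matrix.single_apply, Finset.sum_add_distrib]
        using hdiag
    · simp [MOUS.unitMat, Matrix.sum_apply, Matrix.single_apply, Finset.sum_add_distrib, ite_and,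
        hij]
  · simp [Matrix.sum_apply, Matrix.single_apply, Finset.sum_add_distrib, ite_and]
  · simp [Matrix.sum_apply, Matrix.single_apply, Finset.sum_add_distrib, ite_and, hsa, hsb]
  · rcases eq_or_ne i j with rfl | hij
    · simpa [MOUS.unitMat, Matrix.sum_apply, Matrix.single_apply, Finset.sum_add_distrib]
        using hdiag
    · simp [MOUS.unitMat, Matrix.sum_apply, Matrix.single_apply, Finset.sum_add_distrib, ite_and,
        hij]

end Norm

/-- **Statement 17** (Lemma 7.1 of the paper).  Let `(V, L)` be a quantized metric space,
`x = [x_{st}] ∈ M_k(V)` with `x_{st} = x_{st}^{(1)} + i x_{st}^{(2)}`, where each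
`x_{st}^{(p)}` is self-adjoint, and suppose `λ_{st}^{(p)} ∈ σ(x_{st}^{(p)})`.  Then
`‖x − [(λ_{st}^{(1)} + i λ_{st}^{(2)}) 1]‖_k ≤ 2 k² L_k(x) diam(V, L)`. -/
theorem norm_sub_spectral_scalar_le (A : MOUS)
    (L : ∀ n : ℕ, Matrix (Fin n) (Fin n) A.carrier → ℝ)
    (hL : IsMatrixLipNorm A L) (k : ℕ)
    (x x1 x2 : Matrix (Fin k) (Fin k) A.carrier)
    (hx1 : ∀ s t, star (x1 s t) = x1 s t) (hx2 : ∀ s t, star (x2 s t) = x2 s t)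
    (hx : x = Matrix.of fun s t => x1 s t + Complex.I • x2 s t)
    (lam1 lam2 : Fin k → Fin k → ℝ)
    (h1 : ∀ s t, lam1 s t ∈ ospec A (x1 s t))
    (h2 : ∀ s t, lam2 s t ∈ ospec A (x2 s t)) :
    A.matNorm
        (x - Matrix.of fun s t => (((lam1 s t : ℂ) + Complex.I * (lam2 s t : ℂ)) • A.one))
      ≤ 2 * (k : ℝ) ^ 2 * L k x * qDiam A L := by
  subst hx
  have hsa : ∀ s t, star ((x1 - Matrix.of fun s t => lam1 s t • A.one) s t)
      = (x1 - Matrix.of fun s t => lam1 s t • A.one) s t := fun s t => by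
    simp [MOUS.star_real_smul, A.star_one, hx1]
  have hsb : ∀ s t, star ((x2 - Matrix.of fun s t => lam2 s t • A.one) s t)
      = (x2 - Matrix.of fun s t => lam2 s t • A.one) s t := fun s t => by
    simp [MOUS.star_real_smul, A.star_one, hx2]
  set x : Matrix (Fin k) (Fin k) A.carrier :=
    Matrix.of fun s t => x1 s t + Complex.I • x2 s t with hx
  have hL' := hL.toIsMatrixLipschitzSeminorm
  have hd := qDiam_nonneg (A := A) (L := L)
  have hl1 : ∀ s t, L 1 (Matrix.of fun _ _ => x1 s t) ≤ L k x := fun s t =>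
    (lip_realPart_le hL' (hx1 s t) (hx2 s t)).trans (lip_entry_le hL' x s t)
  have hl2 : ∀ s t, L 1 (Matrix.of fun _ _ => x2 s t) ≤ L k x := fun s t =>
    (lip_imaginaryPart_le hL' (hx1 s t) (hx2 s t)).trans (lip_entry_le hL' x s t)
  have hR : 0 ≤ L k x * qDiam A L := mul_nonneg (hL.nonneg k x) hd
  set R := L k x * qDiam A L with hRdef
  have key : ∀ C : ℝ, R < C → A.matNorm
      (x - Matrix.of fun s t => (((lam1 s t : ℂ) + Complex.I * (lam2 s t : ℂ)) • A.one))
      ≤ 2 * (k : ℝ) * C := fun C hC => by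
    have hb1 := fun s t => nonneg_of_mem_ospec hL (hx1 s t) (h1 s t)
      ((mul_le_mul_of_nonneg_right (hl1 s t) hd).trans_lt hC)
    have hb2 := fun s t => nonneg_of_mem_ospec hL (hx2 s t) (h2 s t)
      ((mul_le_mul_of_nonneg_right (hl2 s t) hd).trans_lt hC)
    have h := sumPos_of_entrywise hsa hsb (fun s t => (hb1 s t).1) (fun s t => (hb1 s t).2)
      (fun s t => (hb2 s t).1) (fun s t => (hb2 s t).2)
    have e : x1 - (Matrix.of fun s t => lam1 s t • A.one)
        + Complex.I • (x2 - Matrix.of fun s t => lam2 s t • A.one)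
        = x - Matrix.of fun s t => (((lam1 s t : ℂ) + Complex.I * (lam2 s t : ℂ)) • A.one) := by
      ext s t
      simp only [hx, Matrix.add_apply, Matrix.sub_apply, Matrix.smul_apply, Matrix.of_apply,
        ← Complex.coe_smul]
      module
    rw [e] at h
    have hC0 : 0 ≤ 2 * (k : ℝ) * C := by
      have := hR.trans hC.le
      positivity
    unfold MOUS.matNorm
    by_cases hbdd : BddBelow {t : ℝ | (Matrix.reindex finSumFinEquiv finSumFinEquiv
        (Matrix.fromBlocks ((t : ℂ) • A.unitMat k)
          (x - Matrix.of fun s t => (((lam1 s t : ℂ) + Complex.I * (lam2 s t : ℂ)) • A.one))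
          (x - Matrix.of fun s t =>
            (((lam1 s t : ℂ) + Complex.I * (lam2 s t : ℂ)) • A.one)).conjTranspose
          ((t : ℂ) • A.unitMat k))) ∈ A.pos (k + k)}
    · exact csInf_le hbdd h
    · rw [Real.sInf_of_not_bddBelow hbdd]
      exact hC0
  have hk : (k : ℝ) ≤ (k : ℝ) ^ 2 := by exact_mod_cast Nat.le_self_pow two_ne_zero k
  have hlim : A.matNorm
      (x - Matrix.of fun s t => (((lam1 s t : ℂ) + Complex.I * (lam2 s t : ℂ)) • A.one))
      ≤ 2 * (k : ℝ) * R := by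
    have hcont : Filter.Tendsto (fun C : ℝ => 2 * (k : ℝ) * C) (nhdsWithin R (Set.Ioi R))
        (nhds (2 * (k : ℝ) * R)) :=
      (continuous_const_mul (2 * (k : ℝ))).continuousWithinAt
    exact ge_of_tendsto hcont (Filter.eventually_of_mem self_mem_nhdsWithin key)
  calc _ ≤ 2 * (k : ℝ) * R := hlim
    _ ≤ 2 * (k : ℝ) ^ 2 * R := by gcongr
    _ = 2 * (k : ℝ) ^ 2 * L k x * qDiam A L := by rw [hRdef]; ring

end
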